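/- For every natural number n there exists a constant C > 0, depending only on n, such that for all nonempty bounded subsets X, Y of the Euclidean space ℝⁿ the following inequalities hold: d_GH(X, Y) ≤ d_EH(X, Y) ≤ C · M^(1/2) · (d_GH(X, Y))^(1/2), where M = max{diam X, diam Y}, d_EH(X, Y) = inf over all isometries T of ℝⁿ of the Hausdorff distance d_H(X, T(Y)), and d_GH(X, Y) is the Gromov–Hausdorff distance between X and Y (equivalently, between their compact closures). -/

import Mathlib

open Bornology

/-- The Gromov–Hausdorff distance between two nonempty bounded subsets of `ℝⁿ`, defined as the
Gromov–Hausdorff distance between their (compact, nonempty) closures. -/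
noncomputable def dGH {n : ℕ} (X Y : Set (EuclideanSpace ℝ (Fin n)))
    (hX : IsBounded X) (hY : IsBounded Y) (hXne : X.Nonempty) (hYne : Y.Nonempty) : ℝ :=
  haveI : CompactSpace (closure X) := isCompact_iff_compactSpace.mp hX.isCompact_closure
  haveI : CompactSpace (closure Y) := isCompact_iff_compactSpace.mp hY.isCompact_closure
  haveI : Nonempty (closure X) := hXne.closure.to_subtype
  haveI : Nonempty (closure Y) := hYne.closure.to_subtype
  GromovHausdorff.ghDist (closure X) (closure Y)

/-- The Euclidean Gromov–Hausdorff distance between two subsets of `ℝⁿ`: the infimum over all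
surjective isometries `T` of `ℝⁿ` of the Hausdorff distance between `X` and `T(Y)`. -/
noncomputable def dEH {n : ℕ} (X Y : Set (EuclideanSpace ℝ (Fin n))) : ℝ :=
  ⨅ T : EuclideanSpace ℝ (Fin n) ≃ᵢ EuclideanSpace ℝ (Fin n),
    Metric.hausdorffDist X (T '' Y)

/-- A bounded family taking values above some `ε ≥ 0` takes such a value that is also at least half
of every other value. -/
theorem exists_lt_forall_le_two_mul {ι : Type*} {f : ι → ℝ} {ε : ℝ}
    (hf : BddAbove (Set.range f)) (hε : 0 ≤ ε) (h : ∃ i, ε < f i) :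
    ∃ i, ε < f i ∧ ∀ j, f j ≤ 2 * f i := by
  obtain ⟨i₀, hi₀⟩ := h
  have hle (j : ι) : f j ≤ ⨆ i, f i := le_ciSup hf j
  have : Nonempty ι := ⟨i₀⟩
  obtain ⟨i, hi⟩ := exists_lt_of_lt_ciSup
    (max_lt (hi₀.trans_le (hle i₀)) (half_lt_self (hε.trans_lt (hi₀.trans_le (hle i₀)))))
  refine ⟨i, (le_max_left _ _).trans_lt hi, fun j => ?_⟩
  linarith [hle j, (le_max_right _ _).trans_lt hi]

theorem abs_sq_sub_sq_le {a b M δ : ℝ} (ha : 0 ≤ a) (hb : 0 ≤ b) (haM : a ≤ M) (hbM : b ≤ M)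
    (h : |a - b| ≤ δ) : |a ^ 2 - b ^ 2| ≤ 2 * M * δ := by
  rw [sq_sub_sq, abs_mul, abs_of_nonneg (add_nonneg ha hb)]
  have : 0 ≤ M := ha.trans haM
  gcongr
  linarith

section GramStability

open Module
open scoped InnerProductSpace

variable {V W : Type*} [NormedAddCommGroup V] [InnerProductSpace ℝ V]
  [NormedAddCommGroup W] [InnerProductSpace ℝ W]

theorem coe_orthogonalProjection_orthogonal_unit {u : V} (hu : ‖u‖ = 1) (v : V) :
    ((ℝ ∙ u)ᗮ.orthogonalProjectionOnto v : V) = v - ⟪u, v⟫_ℝ • u := by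
  rw [← Submodule.starProjection_apply, Submodule.starProjection_orthogonal_val,
    Submodule.starProjection_unit_singleton ℝ hu]

theorem inner_orthogonalProjection_orthogonal_unit {u : V} (hu : ‖u‖ = 1) (v v' : V) :
    ⟪(ℝ ∙ u)ᗮ.orthogonalProjectionOnto v, (ℝ ∙ u)ᗮ.orthogonalProjectionOnto v'⟫_ℝ =
      ⟪v, v'⟫_ℝ - ⟪u, v⟫_ℝ * ⟪u, v'⟫_ℝ := by
  rw [Submodule.coe_inner, coe_orthogonalProjection_orthogonal_unit hu,
    coe_orthogonalProjection_orthogonal_unit hu]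
  simp only [inner_sub_left, inner_sub_right, real_inner_smul_left, real_inner_smul_right,
    real_inner_self_eq_norm_sq, hu, real_inner_comm u v]
  ring

/-- A linear isometry between the orthogonal complements of two unit vectors extends to a linear
isometry sending one unit vector to the other. -/
theorem LinearIsometry.exists_extend_orthogonal_unit {u : V} {w : W} (hu : ‖u‖ = 1) (hw : ‖w‖ = 1)
    (Q : (ℝ ∙ u)ᗮ →ₗᵢ[ℝ] (ℝ ∙ w)ᗮ) :
    ∃ P : V →ₗᵢ[ℝ] W, ∀ v, P v = ⟪u, v⟫_ℝ • w + Q ((ℝ ∙ u)ᗮ.orthogonalProjectionOnto v) := by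
  let L : V →ₗ[ℝ] W := (innerₛₗ ℝ u).smulRight w +
    (ℝ ∙ w)ᗮ.subtype ∘ₗ Q.toLinearMap ∘ₗ (ℝ ∙ u)ᗮ.orthogonalProjectionOnto.toLinearMap
  have hL (v : V) : L v = ⟪u, v⟫_ℝ • w + Q ((ℝ ∙ u)ᗮ.orthogonalProjectionOnto v) := rfl
  refine ⟨⟨L, fun v => ?_⟩, hL⟩
  rw [hL, ← sq_eq_sq₀ (norm_nonneg _) (norm_nonneg _), norm_add_sq_real, real_inner_smul_left,
    Submodule.mem_orthogonal_singleton_iff_inner_right.1 (Q _).2, ← Submodule.coe_norm,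
    Q.norm_map, norm_smul, hw, ← real_inner_self_eq_norm_sq (_ : (ℝ ∙ u)ᗮ),
    inner_orthogonalProjection_orthogonal_unit hu, real_inner_self_eq_norm_sq, mul_one,
    Real.norm_eq_abs, sq_abs]
  ring

theorem norm_le_of_abs_inner_sub_le {x : V} {y : W} {ε c : ℝ} (hc : 0 ≤ c)
    (h : |⟪x, x⟫_ℝ - ⟪y, y⟫_ℝ| ≤ ε ^ 2) (hcε : ‖x‖ ^ 2 + ε ^ 2 ≤ c ^ 2) : ‖y‖ ≤ c := by
  rw [real_inner_self_eq_norm_sq, real_inner_self_eq_norm_sq] at h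
  refine (sq_le_sq₀ (norm_nonneg _) hc).1 ?_
  linarith [(abs_le.1 h).1]

/-- If the Gram matrices of two families of vectors are close, then so are the components of these
families along vectors `x₀` and `y₀` corresponding to each other, provided that `x₀` is
not too short. -/
theorem norm_mul_abs_inner_normalize_sub_le {x₀ x : V} {y₀ y : W} {ε : ℝ} (hε : 0 ≤ ε)
    (hεx : ε < ‖x₀‖) (h₀ : |⟪x₀, x₀⟫_ℝ - ⟪y₀, y₀⟫_ℝ| ≤ ε ^ 2)
    (hxy : |⟪x₀, x⟫_ℝ - ⟪y₀, y⟫_ℝ| ≤ ε ^ 2) (hy : ‖y‖ ≤ 3 * ‖x₀‖) (hy₀ : y₀ ≠ 0) :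
    ‖x₀‖ * |⟪‖x₀‖⁻¹ • x₀, x⟫_ℝ - ⟪‖y₀‖⁻¹ • y₀, y⟫_ℝ| ≤ 4 * ε ^ 2 := by
  have ha : 0 < ‖x₀‖ := hε.trans_lt hεx
  have hb : 0 < ‖y₀‖ := norm_pos_iff.2 hy₀
  rw [real_inner_self_eq_norm_sq, real_inner_self_eq_norm_sq] at h₀
  have hβ : |⟪‖y₀‖⁻¹ • y₀, y⟫_ℝ| ≤ 3 * ‖x₀‖ := by
    refine (abs_real_inner_le_norm _ _).trans ?_
    rwa [norm_smul, norm_inv, norm_norm, inv_mul_cancel₀ hb.ne', one_mul]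
  set β := ⟪‖y₀‖⁻¹ • y₀, y⟫_ℝ with hβ_def
  have hyβ : ⟪y₀, y⟫_ℝ = ‖y₀‖ * β := by
    rw [hβ_def, real_inner_smul_left, mul_inv_cancel_left₀ hb.ne']
  have hxα : ⟪x₀, x⟫_ℝ = ‖x₀‖ * ⟪‖x₀‖⁻¹ • x₀, x⟫_ℝ := by
    rw [real_inner_smul_left, mul_inv_cancel_left₀ ha.ne']
  have hba : |‖y₀‖ - ‖x₀‖| * ‖x₀‖ ≤ ε ^ 2 := by
    refine le_trans ?_ h₀
    rw [abs_sub_comm, sq_sub_sq, mul_comm, abs_mul, abs_of_pos (add_pos ha hb)]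
    gcongr
    linarith
  calc ‖x₀‖ * |⟪‖x₀‖⁻¹ • x₀, x⟫_ℝ - β|
      = |(⟪x₀, x⟫_ℝ - ⟪y₀, y⟫_ℝ) + (‖y₀‖ - ‖x₀‖) * β| := by
        rw [← abs_of_pos ha, ← abs_mul, abs_of_pos ha, hyβ, hxα]
        congr 1
        ring
    _ ≤ ε ^ 2 + |‖y₀‖ - ‖x₀‖| * (3 * ‖x₀‖) := by
        refine (abs_add_le _ _).trans (add_le_add hxy ?_)
        rw [abs_mul]
        gcongr
    _ ≤ 4 * ε ^ 2 := by linarith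

end GramStability

section

open Module
open scoped InnerProductSpace

universe u v w

/-- Two families of vectors whose Gram matrices differ by at most `ε ^ 2` entrywise are matched up
to a multiple of `ε`, depending only on the dimension, by a linear isometry. -/
theorem exists_linearIsometry_of_abs_inner_sub_inner_le (n : ℕ) : ∃ C ≥ (3 : ℝ),
    ∀ (V : Type u) (W : Type v) [NormedAddCommGroup V] [InnerProductSpace ℝ V]
      [NormedAddCommGroup W] [InnerProductSpace ℝ W] [FiniteDimensional ℝ V]
      [FiniteDimensional ℝ W] (_ : finrank ℝ V = n) (_ : finrank ℝ W = n)
      (ι : Type w) (x : ι → V) (y : ι → W) (B ε : ℝ) (_ : ∀ i, ‖x i‖ ≤ B) (_ : 0 ≤ ε)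
      (_ : ∀ i j, |⟪x i, x j⟫_ℝ - ⟪y i, y j⟫_ℝ| ≤ ε ^ 2),
      ∃ Q : V →ₗᵢ[ℝ] W, ∀ i, ‖Q (x i) - y i‖ ≤ C * ε := by
  induction n with
  | zero =>
    refine ⟨3, le_rfl, fun V W _ _ _ _ _ _ hV hW ι x y B ε _ hε _ => ?_⟩
    have := finrank_zero_iff.1 hW
    refine ⟨((stdOrthonormalBasis ℝ V).equiv (stdOrthonormalBasis ℝ W)
      (finCongr (hV.trans hW.symm))).toLinearIsometry, fun i => ?_⟩
    rw [Subsingleton.elim (_ - _) (0 : W), norm_zero]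
    positivity
  | succ n ih =>
    obtain ⟨C, hC, ih⟩ := ih
    refine ⟨4 + 5 * C, by linarith, fun V W _ _ _ _ _ _ hV hW ι x y B ε hB hε h => ?_⟩
    by_cases hsmall : ∀ i, ‖x i‖ ≤ ε
    · refine ⟨((stdOrthonormalBasis ℝ V).equiv (stdOrthonormalBasis ℝ W)
      (finCongr (hV.trans hW.symm))).toLinearIsometry, fun i => ?_⟩
      have hy : ‖y i‖ ≤ 2 * ε := by
        refine norm_le_of_abs_inner_sub_le (by positivity) (h i i) ?_
        nlinarith [hsmall i, norm_nonneg (x i)]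
      refine (norm_sub_le _ _).trans ?_
      rw [LinearIsometry.norm_map]
      nlinarith [hsmall i]
    obtain ⟨i₀, hεi, hmax⟩ := exists_lt_forall_le_two_mul (f := fun i => ‖x i‖)
      ⟨B, by rintro _ ⟨i, rfl⟩; exact hB i⟩ hε (by simpa using hsmall)
    have ha : 0 < ‖x i₀‖ := hε.trans_lt hεi
    have hy₀ : y i₀ ≠ 0 := by
      intro h0
      have := (abs_le.1 (h i₀ i₀)).2
      rw [h0, inner_zero_left, real_inner_self_eq_norm_sq, sub_zero] at this
      exact hεi.not_ge ((sq_le_sq₀ ha.le hε).1 this)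
    have hy (i : ι) : ‖y i‖ ≤ 3 * ‖x i₀‖ := by
      refine norm_le_of_abs_inner_sub_le (by positivity) (h i i) ?_
      nlinarith [hmax i, norm_nonneg (x i)]
    have hcomp (i : ι) := norm_mul_abs_inner_normalize_sub_le hε hεi (h i₀ i₀) (h i₀ i)
      (hy i) hy₀
    set p : V := ‖x i₀‖⁻¹ • x i₀
    set q : W := ‖y i₀‖⁻¹ • y i₀
    have hp : ‖p‖ = 1 := norm_smul_inv_norm (𝕜 := ℝ) (norm_pos_iff.1 ha)
    have hq : ‖q‖ = 1 := norm_smul_inv_norm (𝕜 := ℝ) hy₀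
    have hα (i : ι) : |⟪p, x i⟫_ℝ| ≤ 2 * ‖x i₀‖ := by
      simpa [hp] using (abs_real_inner_le_norm p (x i)).trans (by rw [hp, one_mul]; exact hmax i)
    have hβ (i : ι) : |⟪q, y i⟫_ℝ| ≤ 3 * ‖x i₀‖ :=
      (abs_real_inner_le_norm q (y i)).trans (by rw [hq, one_mul]; exact hy i)
    have hdiff (i : ι) : |⟪p, x i⟫_ℝ - ⟪q, y i⟫_ℝ| ≤ 4 * ε := by
      refine le_of_mul_le_mul_left ((hcomp i).trans ?_) ha
      nlinarith
    have hprod (i j : ι) : |⟪p, x i⟫_ℝ * ⟪p, x j⟫_ℝ - ⟪q, y i⟫_ℝ * ⟪q, y j⟫_ℝ| ≤ 20 * ε ^ 2 := by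
      calc |⟪p, x i⟫_ℝ * ⟪p, x j⟫_ℝ - ⟪q, y i⟫_ℝ * ⟪q, y j⟫_ℝ|
          = |(⟪p, x i⟫_ℝ - ⟪q, y i⟫_ℝ) * ⟪p, x j⟫_ℝ
              + ⟪q, y i⟫_ℝ * (⟪p, x j⟫_ℝ - ⟪q, y j⟫_ℝ)| := by
            congr 1
            ring
        _ ≤ |⟪p, x i⟫_ℝ - ⟪q, y i⟫_ℝ| * (2 * ‖x i₀‖)
              + (3 * ‖x i₀‖) * |⟪p, x j⟫_ℝ - ⟪q, y j⟫_ℝ| := by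
            refine (abs_add_le _ _).trans ?_
            rw [abs_mul, abs_mul]
            gcongr
            · exact hα j
            · exact hβ i
        _ ≤ 20 * ε ^ 2 := by linarith [hcomp i, hcomp j]
    have : Fact (finrank ℝ V = n + 1) := ⟨hV⟩
    have : Fact (finrank ℝ W = n + 1) := ⟨hW⟩
    obtain ⟨Q, hQ⟩ := ih (ℝ ∙ p)ᗮ (ℝ ∙ q)ᗮ
      (Submodule.finrank_orthogonal_span_singleton (norm_ne_zero_iff.1 (by simp [hp])))
      (Submodule.finrank_orthogonal_span_singleton (norm_ne_zero_iff.1 (by simp [hq]))) ι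
      (fun i => (ℝ ∙ p)ᗮ.orthogonalProjectionOnto (x i))
      (fun i => (ℝ ∙ q)ᗮ.orthogonalProjectionOnto (y i))
      B (5 * ε) (fun i => (Submodule.norm_orthogonalProjectionOnto_apply_le _ _).trans (hB i))
      (by positivity) (fun i j => by
        rw [inner_orthogonalProjection_orthogonal_unit hp,
          inner_orthogonalProjection_orthogonal_unit hq, sub_sub_sub_comm]
        refine (abs_sub _ _).trans ((add_le_add (h i j) (hprod i j)).trans ?_)
        nlinarith [sq_nonneg ε])
    obtain ⟨P, hP⟩ := LinearIsometry.exists_extend_orthogonal_unit hp hq Q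
    refine ⟨P, fun i => ?_⟩
    have hsplit : P (x i) - y i = (⟪p, x i⟫_ℝ - ⟪q, y i⟫_ℝ) • q +
        ((Q ((ℝ ∙ p)ᗮ.orthogonalProjectionOnto (x i)) - (ℝ ∙ q)ᗮ.orthogonalProjectionOnto (y i) :
          (ℝ ∙ q)ᗮ) : W) := by
      rw [hP, Submodule.coe_sub, coe_orthogonalProjection_orthogonal_unit hq, sub_smul]
      abel
    rw [hsplit]
    refine (norm_add_le _ _).trans ?_
    rw [norm_smul, hq, mul_one, Real.norm_eq_abs, ← Submodule.coe_norm]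
    linarith [hdiff i, hQ i]

end

section

open scoped InnerProductSpace

variable {V W : Type*} [NormedAddCommGroup V] [InnerProductSpace ℝ V]
  [NormedAddCommGroup W] [InnerProductSpace ℝ W]

theorem abs_inner_sub_inner_le_of_abs_norm_sub_le {x x' : V} {y y' : W} {M δ : ℝ}
    (hx : ‖x‖ ≤ M) (hy : ‖y‖ ≤ M) (hx' : ‖x'‖ ≤ M) (hy' : ‖y'‖ ≤ M)
    (hxx : ‖x - x'‖ ≤ M) (hyy : ‖y - y'‖ ≤ M) (h : |‖x‖ - ‖y‖| ≤ δ) (h' : |‖x'‖ - ‖y'‖| ≤ δ)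
    (hd : |‖x - x'‖ - ‖y - y'‖| ≤ δ) :
    |⟪x, x'⟫_ℝ - ⟪y, y'⟫_ℝ| ≤ 3 * M * δ := by
  have h₁ := abs_le.1 (abs_sq_sub_sq_le (norm_nonneg _) (norm_nonneg _) hx hy h)
  have h₂ := abs_le.1 (abs_sq_sub_sq_le (norm_nonneg _) (norm_nonneg _) hx' hy' h')
  have h₃ := abs_le.1 (abs_sq_sub_sq_le (norm_nonneg _) (norm_nonneg _) hxx hyy hd)
  rw [norm_sub_sq_real, norm_sub_sq_real] at h₃
  refine abs_le.2 ⟨?_, ?_⟩ <;> linarith [h₁.1, h₁.2, h₂.1, h₂.2, h₃.1, h₃.2]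

end

theorem IsometryEquiv.image_closure {α β : Type*} [PseudoEMetricSpace α] [PseudoEMetricSpace β]
    (T : α ≃ᵢ β) (s : Set α) : T '' closure s = closure (T '' s) :=
  T.toHomeomorph.image_closure s

theorem abs_dist_sub_dist_le {γ : Type*} [PseudoMetricSpace γ] {a b a' b' : γ} {r : ℝ}
    (h : dist a b ≤ r) (h' : dist a' b' ≤ r) : |dist a a' - dist b b'| ≤ 2 * r := by
  have := dist_triangle4 a b b' a'
  have := dist_triangle4 b a a' b'
  rw [dist_comm b' a'] at *
  rw [dist_comm b a] at *
  exact abs_le.2 ⟨by linarith, by linarith⟩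

section

variable {n : ℕ}

local notation "E" => EuclideanSpace ℝ (Fin n)

theorem dEH_le_hausdorffDist (X Y : Set E) (T : E ≃ᵢ E) :
    dEH X Y ≤ Metric.hausdorffDist X (T '' Y) :=
  ciInf_le ⟨0, by rintro _ ⟨S, rfl⟩; exact Metric.hausdorffDist_nonneg⟩ T

theorem dGH_le_dEH (X Y : Set E) (hX : IsBounded X) (hY : IsBounded Y) (hXne : X.Nonempty)
    (hYne : Y.Nonempty) : dGH X Y hX hY hXne hYne ≤ dEH X Y := by
  refine le_ciInf fun T => ?_
  have : CompactSpace (closure X) := isCompact_iff_compactSpace.mp hX.isCompact_closure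
  have : CompactSpace (closure Y) := isCompact_iff_compactSpace.mp hY.isCompact_closure
  have : Nonempty (closure X) := hXne.closure.to_subtype
  have : Nonempty (closure Y) := hYne.closure.to_subtype
  have h := GromovHausdorff.ghDist_le_hausdorffDist (X := closure X) (Y := closure Y)
    isometry_subtype_coe (T.isometry.comp isometry_subtype_coe)
  rwa [Set.range_comp, Subtype.range_coe, Subtype.range_coe, IsometryEquiv.image_closure T Y,
    Metric.hausdorffDist_closure] at h

/-- Points of `X` and `Y` put in correspondence by a coupling realizing the Gromov–Hausdorff
distance up to `r`. -/
theorem exists_correspondence_of_dGH_lt (X Y : Set E) (hX : IsBounded X) (hY : IsBounded Y)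
    (hXne : X.Nonempty) (hYne : Y.Nonempty) {r : ℝ} (hr : dGH X Y hX hY hXne hYne < r) :
    ∃ R : Set (E × E), (∀ p ∈ R, p.1 ∈ closure X ∧ p.2 ∈ closure Y) ∧
      (∀ x ∈ closure X, ∃ y, (x, y) ∈ R) ∧ (∀ y ∈ closure Y, ∃ x, (x, y) ∈ R) ∧
      ∀ p ∈ R, ∀ q ∈ R, |dist p.1 q.1 - dist p.2 q.2| ≤ 2 * r := by
  have : CompactSpace (closure X) := isCompact_iff_compactSpace.mp hX.isCompact_closure
  have : CompactSpace (closure Y) := isCompact_iff_compactSpace.mp hY.isCompact_closure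
  have : Nonempty (closure X) := hXne.closure.to_subtype
  have : Nonempty (closure Y) := hYne.closure.to_subtype
  obtain ⟨Φ, Ψ, hΦ, hΨ, hd⟩ := GromovHausdorff.ghDist_eq_hausdorffDist (closure X) (closure Y)
  have hlt : Metric.hausdorffDist (Set.range Φ) (Set.range Ψ) < r := hd ▸ hr
  have hfin : Metric.hausdorffEDist (Set.range Φ) (Set.range Ψ) ≠ ⊤ :=
    Metric.hausdorffEDist_ne_top_of_nonempty_of_bounded (Set.range_nonempty _)
      (Set.range_nonempty _) (isCompact_range hΦ.continuous).isBounded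
      (isCompact_range hΨ.continuous).isBounded
  refine ⟨{p | ∃ (hx : p.1 ∈ closure X) (hy : p.2 ∈ closure Y),
    dist (Φ ⟨p.1, hx⟩) (Ψ ⟨p.2, hy⟩) < r}, fun p ⟨hx, hy, _⟩ => ⟨hx, hy⟩, fun x hx => ?_,
    fun y hy => ?_, ?_⟩
  · obtain ⟨_, ⟨y, rfl⟩, hxy⟩ :=
      Metric.exists_dist_lt_of_hausdorffDist_lt (Set.mem_range_self ⟨x, hx⟩) hlt hfin
    exact ⟨y, hx, y.2, hxy⟩
  · obtain ⟨_, ⟨x, rfl⟩, hxy⟩ :=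
      Metric.exists_dist_lt_of_hausdorffDist_lt' (Set.mem_range_self ⟨y, hy⟩) hlt hfin
    exact ⟨x, x.2, hy, hxy⟩
  · rintro p ⟨hpx, hpy, hp⟩ q ⟨hqx, hqy, hq⟩
    have := abs_dist_sub_dist_le hp.le hq.le
    rwa [hΦ.dist_eq, hΨ.dist_eq] at this

/-- A correspondence of small distortion between bounded sets is close to the restriction of an
isometry of the ambient Euclidean space. -/
theorem exists_isometryEquiv_of_correspondence : ∃ C > (0 : ℝ),
    ∀ (R : Set (E × E)) (M δ : ℝ), R.Nonempty → 0 ≤ M → 0 ≤ δ →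
      (∀ p ∈ R, ∀ q ∈ R, dist p.1 q.1 ≤ M ∧ dist p.2 q.2 ≤ M ∧
        |dist p.1 q.1 - dist p.2 q.2| ≤ δ) →
      ∃ T : E ≃ᵢ E, ∀ p ∈ R, dist p.1 (T p.2) ≤ C * √(3 * M * δ) := by
  obtain ⟨C, hC, hmain⟩ := exists_linearIsometry_of_abs_inner_sub_inner_le n
  refine ⟨C, by linarith, fun R M δ ⟨o, ho⟩ hM hδ hR => ?_⟩
  obtain ⟨Q, hQ⟩ := hmain E E finrank_euclideanSpace_fin finrank_euclideanSpace_fin R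
    (fun p => p.1.2 - o.2) (fun p => p.1.1 - o.1) M (√(3 * M * δ))
    (fun p => by simpa [dist_eq_norm] using (hR p p.2 o ho).2.1) (Real.sqrt_nonneg _)
    (fun p q => by
      rw [Real.sq_sqrt (by positivity), abs_sub_comm]
      have hp := hR p p.2 o ho
      have hq := hR q q.2 o ho
      have hpq := hR p p.2 q q.2
      simp only [dist_eq_norm] at hp hq hpq
      exact abs_inner_sub_inner_le_of_abs_norm_sub_le hp.1 hp.2.1 hq.1 hq.2.1
        (by simpa using hpq.1) (by simpa using hpq.2.1) hp.2.2 hq.2.2 (by simpa using hpq.2.2))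
  refine ⟨((IsometryEquiv.subRight o.2).trans (Q.toLinearIsometryEquiv rfl).toIsometryEquiv).trans
    (IsometryEquiv.addRight o.1), fun p hp => ?_⟩
  have := hQ ⟨p, hp⟩
  rw [dist_comm, dist_eq_norm]
  simpa [sub_sub_eq_add_sub] using this

theorem dEH_le_of_correspondence (X Y : Set E) {R : Set (E × E)} {T : E ≃ᵢ E} {ρ : ℝ} (hρ : 0 ≤ ρ)
    (hR : ∀ p ∈ R, p.1 ∈ closure X ∧ p.2 ∈ closure Y) (hRX : ∀ x ∈ closure X, ∃ y, (x, y) ∈ R)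
    (hRY : ∀ y ∈ closure Y, ∃ x, (x, y) ∈ R) (hT : ∀ p ∈ R, dist p.1 (T p.2) ≤ ρ) :
    dEH X Y ≤ ρ := by
  refine (dEH_le_hausdorffDist X Y T).trans ?_
  rw [← Metric.hausdorffDist_closure, ← IsometryEquiv.image_closure T Y]
  refine Metric.hausdorffDist_le_of_mem_dist hρ (fun x hx => ?_) ?_
  · obtain ⟨y, hy⟩ := hRX x hx
    exact ⟨T y, Set.mem_image_of_mem _ (hR (x, y) hy).2, hT (x, y) hy⟩
  · rintro _ ⟨y, hy, rfl⟩
    obtain ⟨x, hx⟩ := hRY y hy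
    exact ⟨x, (hR (x, y) hx).1, (dist_comm _ _).trans_le (hT (x, y) hx)⟩

end

/-- Memoli's inequality for nonempty bounded subsets of `ℝⁿ`: there is a constant `C > 0`
depending only on `n` such that
`d_GH(X, Y) ≤ d_EH(X, Y) ≤ C · M^{1/2} · d_GH(X, Y)^{1/2}` where `M = max (diam X) (diam Y)`. -/
theorem memoli_inequality_bounded (n : ℕ) :
    ∃ C > (0 : ℝ), ∀ (X Y : Set (EuclideanSpace ℝ (Fin n)))
      (hX : IsBounded X) (hY : IsBounded Y) (hXne : X.Nonempty) (hYne : Y.Nonempty),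
      dGH X Y hX hY hXne hYne ≤ dEH X Y ∧
      dEH X Y ≤ C * Real.sqrt (max (Metric.diam X) (Metric.diam Y)) *
        Real.sqrt (dGH X Y hX hY hXne hYne) := by
  obtain ⟨C, hC, hmain⟩ := exists_isometryEquiv_of_correspondence (n := n)
  refine ⟨C * √6, by positivity, fun X Y hX hY hXne hYne => ⟨dGH_le_dEH X Y hX hY hXne hYne, ?_⟩⟩
  set M := max (Metric.diam X) (Metric.diam Y)
  have hM : 0 ≤ M := Metric.diam_nonneg.trans (le_max_left _ _)
  have hbound (r : ℝ) (hr : dGH X Y hX hY hXne hYne < r) : dEH X Y ≤ C * √6 * √M * √r := by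
    obtain ⟨R, hR, hRX, hRY, hdist⟩ := exists_correspondence_of_dGH_lt X Y hX hY hXne hYne hr
    have hr0 : 0 ≤ r := le_trans dist_nonneg hr.le
    obtain ⟨x, hx⟩ := hXne.closure
    obtain ⟨y, hxy⟩ := hRX x hx
    have hdiam {S : Set (EuclideanSpace ℝ (Fin n))} (hS : IsBounded S) {a b}
        (ha : a ∈ closure S) (hb : b ∈ closure S) : dist a b ≤ Metric.diam S := by
      rw [← Metric.diam_closure]
      exact Metric.dist_le_diam_of_mem hS.closure ha hb
    obtain ⟨T, hT⟩ := hmain R M (2 * r) ⟨_, hxy⟩ hM (by positivity) fun p hp q hq =>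
      ⟨(hdiam hX (hR p hp).1 (hR q hq).1).trans (le_max_left _ _),
        (hdiam hY (hR p hp).2 (hR q hq).2).trans (le_max_right _ _), hdist p hp q hq⟩
    refine (dEH_le_of_correspondence X Y (by positivity) hR hRX hRY hT).trans_eq ?_
    rw [show 3 * M * (2 * r) = 6 * (M * r) by ring, Real.sqrt_mul (by norm_num),
      Real.sqrt_mul hM]
    ring
  have hcont : Continuous fun r => C * √6 * √M * √r := by fun_prop
  exact ge_of_tendsto (hcont.continuousWithinAt (s := Set.Ioi (dGH X Y hX hY hXne hYne)))
    (Filter.eventually_of_mem self_mem_nhdsWithin hbound)
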